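/- arXiv:2110.11383 — 3 statements merged into one kernel-verified Lean document; each statement's English description precedes it below -/
import Mathlib

section
/- Supergradient property of the optimal dual variable for the perturbation function. Let π* be an optimal feasible policy (so P(0) = V_0^{π*}(ρ)) and let λ* ∈ ℝ^N with λ*_i ≥ 0 for all i satisfy strong duality: sup_π V_L^{π,λ*}(ρ) = V_0^{π*}(ρ). Then for every φ ∈ ℝ^N whose perturbed feasible set is nonempty, P(φ) ≤ P(0) − ∑_{i=1}^N λ*_i φ_i. -/
open Finset

/-- `π` is a (Markov, stationary) policy: a probability distribution over actions per state. -/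
def IsPolicy {S A : Type*} [Fintype A] (π : S → A → ℝ) : Prop :=
  (∀ s a, 0 ≤ π s a) ∧ ∀ s, ∑ a, π s a = 1

/-- `P` is a transition kernel. -/
def IsKernel {S A : Type*} [Fintype S] (P : S → A → S → ℝ) : Prop :=
  (∀ s a s', 0 ≤ P s a s') ∧ ∀ s a, ∑ s', P s a s' = 1

/-- `ρ` is a probability distribution on `S`. -/
def IsDist {S : Type*} [Fintype S] (ρ : S → ℝ) : Prop :=
  (∀ s, 0 ≤ ρ s) ∧ ∑ s, ρ s = 1

/-- `Q` solves the Bellman equation `Q = r + γ P^π Q` for reward `r`, kernel `P`,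
discount `γ` and policy `π` (for `γ ∈ (0,1)` the solution exists and is unique). -/
def IsBellman {S A : Type*} [Fintype S] [Fintype A]
    (P : S → A → S → ℝ) (γ : ℝ) (r : S → A → ℝ) (π : S → A → ℝ)
    (Q : S → A → ℝ) : Prop :=
  ∀ s a, Q s a = r s a + γ * ∑ s', P s a s' * ∑ a', π s' a' * Q s' a'

/-- The value `V^π(ρ) = ∑_s ρ(s) ∑_a π(a|s) Q(s,a)` computed from a `Q`-table. -/
def Vval {S A : Type*} [Fintype S] [Fintype A]
    (ρ : S → ℝ) (π : S → A → ℝ) (Q : S → A → ℝ) : ℝ :=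
  ∑ s, ρ s * ∑ a, π s a * Q s a

/-- Advantage computed from a `Q`-table: `A(s,a) = Q(s,a) − ∑_{a'} π(a'|s) Q(s,a')`. -/
def adv {S A : Type*} [Fintype A] (π : S → A → ℝ) (Q : S → A → ℝ)
    (s : S) (a : A) : ℝ :=
  Q s a - ∑ a', π s a' * Q s a'

/-- Euclidean norm of a table on `S × A` viewed as a vector in `ℝ^{|S||A|}`. -/
noncomputable def tnorm {S A : Type*} [Fintype S] [Fintype A] (f : S → A → ℝ) : ℝ :=
  Real.sqrt (∑ s, ∑ a, (f s a) ^ 2)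

/-- Sup norm of a table on `S × A`. -/
noncomputable def supnorm {S A : Type*} [Fintype S] [Fintype A] (f : S → A → ℝ) : ℝ :=
  ⨆ p : S × A, |f p.1 p.2|

theorem sum_mul_le_of_forall_le {ι : Type*} [Fintype ι] {w f : ι → ℝ} {M : ℝ}
    (hw : ∀ i, 0 ≤ w i) (hw1 : ∑ i, w i = 1) (hf : ∀ i, f i ≤ M) :
    ∑ i, w i * f i ≤ M :=
  calc ∑ i, w i * f i ≤ ∑ i, w i * M :=
        Finset.sum_le_sum fun i _ => mul_le_mul_of_nonneg_left (hf i) (hw i)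
    _ = M := by rw [← Finset.sum_mul, hw1, one_mul]

theorem IsBellman.le_of_reward_le {S A : Type*} [Fintype S] [Fintype A]
    {P : S → A → S → ℝ} (hP : IsKernel P) {γ : ℝ} (hγ : γ ∈ Set.Ioo (0 : ℝ) 1)
    {r π Q : S → A → ℝ} {R : ℝ} (hr : ∀ s a, r s a ≤ R) (hπ : IsPolicy π)
    (hQ : IsBellman P γ r π Q) (s : S) (a : A) : Q s a ≤ R / (1 - γ) := by
  have : Nonempty (S × A) := ⟨(s, a)⟩
  obtain ⟨p, hp⟩ := Finite.exists_max fun p : S × A => Q p.1 p.2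
  have havg : ∑ s', P p.1 p.2 s' * ∑ a', π s' a' * Q s' a' ≤ Q p.1 p.2 :=
    sum_mul_le_of_forall_le (hP.1 _ _) (hP.2 _ _) fun s' =>
      sum_mul_le_of_forall_le (hπ.1 s') (hπ.2 s') fun a' => hp (s', a')
  have hmax : Q p.1 p.2 ≤ R + γ * Q p.1 p.2 :=
    (hQ p.1 p.2).le.trans (add_le_add (hr _ _) (mul_le_mul_of_nonneg_left havg hγ.1.le))
  refine (hp (s, a)).trans ?_
  rw [le_div_iff₀ (sub_pos.mpr hγ.2)]
  linarith

theorem IsBellman.Vval_le {S A : Type*} [Fintype S] [Fintype A]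
    {P : S → A → S → ℝ} (hP : IsKernel P) {γ : ℝ} (hγ : γ ∈ Set.Ioo (0 : ℝ) 1)
    {ρ : S → ℝ} (hρ : IsDist ρ) {r π Q : S → A → ℝ} {R : ℝ} (hr : ∀ s a, r s a ≤ R)
    (hπ : IsPolicy π) (hQ : IsBellman P γ r π Q) : Vval ρ π Q ≤ R / (1 - γ) :=
  sum_mul_le_of_forall_le hρ.1 hρ.2 fun s =>
    sum_mul_le_of_forall_le (hπ.1 s) (hπ.2 s) (hQ.le_of_reward_le hP hγ hr hπ s)

/-- supergradient property of the optimal dual variable for the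
perturbation function: `P(φ) ≤ P(0) − ⟨λ*, φ⟩` where `P(0) = V₀^{π*}(ρ)`. -/
theorem perturbation_supergradient
    {S A : Type*} [Fintype S] [Fintype A] [Nonempty S] [Nonempty A]
    (N : ℕ) (hN : 1 ≤ N)
    (P : S → A → S → ℝ) (hP : IsKernel P)
    (γ : ℝ) (hγ : γ ∈ Set.Ioo (0:ℝ) 1)
    (r0 : S → A → ℝ) (hr0 : ∀ s a, r0 s a ∈ Set.Icc (0:ℝ) 1)
    (rg : Fin N → S → A → ℝ) (hrg : ∀ i s a, rg i s a ∈ Set.Icc (0:ℝ) 1)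
    (ρ : S → ℝ) (hρ : IsDist ρ)
    (b : Fin N → ℝ) (hb : ∀ i, b i ∈ Set.Icc (0:ℝ) (1/(1-γ)))
    (Q0 : (S → A → ℝ) → S → A → ℝ) (Qg : Fin N → (S → A → ℝ) → S → A → ℝ)
    (hQ0 : ∀ π, IsPolicy π → IsBellman P γ r0 π (Q0 π))
    (hQg : ∀ i π, IsPolicy π → IsBellman P γ (rg i) π (Qg i π))
    (πstar : S → A → ℝ) (hπs : IsPolicy πstar)
    (hfeas : ∀ i, Vval ρ πstar (Qg i πstar) ≥ b i)
    (hopt : ∀ π, IsPolicy π → (∀ i, Vval ρ π (Qg i π) ≥ b i) →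
      Vval ρ π (Q0 π) ≤ Vval ρ πstar (Q0 πstar))
    (lamstar : Fin N → ℝ) (hlamnn : ∀ i, 0 ≤ lamstar i)
    (hSD : sSup {x : ℝ | ∃ π, IsPolicy π ∧
        x = Vval ρ π (Q0 π) + ∑ i, lamstar i * (Vval ρ π (Qg i π) - b i)}
      = Vval ρ πstar (Q0 πstar))
    (φ : Fin N → ℝ)
    (hne : ∃ π, IsPolicy π ∧ ∀ i, Vval ρ π (Qg i π) ≥ b i + φ i) :
    sSup {x : ℝ | ∃ π, IsPolicy π ∧
        (∀ i, Vval ρ π (Qg i π) ≥ b i + φ i) ∧ x = Vval ρ π (Q0 π)}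
      ≤ Vval ρ πstar (Q0 πstar) - ∑ i, lamstar i * φ i := by
  have hbdd : BddAbove {x : ℝ | ∃ π, IsPolicy π ∧
      x = Vval ρ π (Q0 π) + ∑ i, lamstar i * (Vval ρ π (Qg i π) - b i)} := by
    refine ⟨1 / (1 - γ) + ∑ i, lamstar i * (1 / (1 - γ) - b i), ?_⟩
    rintro x ⟨π, hπ, rfl⟩
    refine add_le_add ((hQ0 π hπ).Vval_le hP hγ hρ (fun s a => (hr0 s a).2) hπ)
      (Finset.sum_le_sum fun i _ => mul_le_mul_of_nonneg_left ?_ (hlamnn i))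
    exact sub_le_sub_right
      ((hQg i π hπ).Vval_le hP hγ hρ (fun s a => (hrg i s a).2) hπ) _
  obtain ⟨π₀, hπ₀, hfeas₀⟩ := hne
  refine csSup_le ⟨_, π₀, hπ₀, hfeas₀, rfl⟩ ?_
  rintro x ⟨π, hπ, hπφ, rfl⟩
  have hlagr := le_csSup hbdd ⟨π, hπ, rfl⟩
  rw [hSD] at hlagr
  have hslack : ∑ i, lamstar i * φ i ≤ ∑ i, lamstar i * (Vval ρ π (Qg i π) - b i) :=
    Finset.sum_le_sum fun i _ =>
      mul_le_mul_of_nonneg_left (le_sub_iff_add_le'.mpr (hπφ i)) (hlamnn i)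
  linarith
end

section
/- One-step drift of the behavior policy (appendix Lemma on behavior-policy drift, with corrected constant). Let ξ ∈ (0,1], α > 0, ε ∈ [0,1], λ ∈ [0, 2/(ξ(1−γ))]^N, and let Q̂_i : S×A → [0, 1/(1−γ)] for i = 0,…,N. Set Q̂_L = Q̂_0 + ∑_{i=1}^N λ_i Q̂_i. Let θ, θ' : S×A → ℝ with θ' = θ + α·Q̂_L, define the softmax policies π_θ(a|s) = exp(θ(s,a))/∑_{a'}exp(θ(s,a')) and π_{θ'} analogously, and the behavior policies π̂ = ε/|A| + (1−ε)·π_θ and π̂' = ε/|A| + (1−ε)·π_{θ'}. Then ‖π̂' − π̂‖ ≤ 3·(|S||A|)^{1/2}·N·α / (ξ(1−γ)²). -/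
open Finset

/-- If the logits are raised by amounts in `[0, M]`, each softmax probability moves by at
most `M`. -/
theorem abs_softmax_sub_le {A : Type*} [Fintype A] {f g : A → ℝ} {M : ℝ}
    (hfg : ∀ a, f a ≤ g a) (hgf : ∀ a, g a ≤ f a + M) (a : A) :
    |Real.exp (g a) / ∑ b, Real.exp (g b) - Real.exp (f a) / ∑ b, Real.exp (f b)| ≤ M := by
  have hpos : ∀ h : A → ℝ, 0 < ∑ b, Real.exp (h b) := fun h =>
    Finset.sum_pos (fun b _ => Real.exp_pos _) ⟨a, Finset.mem_univ a⟩
  have hle : ∀ h : A → ℝ, Real.exp (h a) / ∑ b, Real.exp (h b) ≤ 1 := fun h =>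
    div_le_one_of_le₀ (Finset.single_le_sum (f := fun b => Real.exp (h b))
      (fun b _ => (Real.exp_pos _).le) (Finset.mem_univ a)) (hpos h).le
  have hM : 0 ≤ M := by linarith [hfg a, hgf a]
  have hexp : 1 - M ≤ Real.exp (-M) := by linarith [Real.add_one_le_exp (-M)]
  have hZ : ∑ b, Real.exp (f b) ≤ ∑ b, Real.exp (g b) :=
    Finset.sum_le_sum fun b _ => Real.exp_le_exp.2 (hfg b)
  have hZ' : Real.exp (-M) * ∑ b, Real.exp (g b) ≤ ∑ b, Real.exp (f b) := by
    rw [Finset.mul_sum]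
    refine Finset.sum_le_sum fun b _ => ?_
    rw [← Real.exp_add]
    exact Real.exp_le_exp.2 (by linarith [hgf b])
  have hup : Real.exp (-M) * (Real.exp (g a) / ∑ b, Real.exp (g b)) ≤
      Real.exp (f a) / ∑ b, Real.exp (f b) := by
    rw [← mul_div_assoc, ← Real.exp_add]
    exact div_le_div₀ (Real.exp_pos _).le (Real.exp_le_exp.2 (by linarith [hgf a])) (hpos f) hZ
  have hdown : Real.exp (-M) * (Real.exp (f a) / ∑ b, Real.exp (f b)) ≤
      Real.exp (g a) / ∑ b, Real.exp (g b) := by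
    rw [← mul_div_assoc, div_le_div_iff₀ (hpos f) (hpos g)]
    calc Real.exp (-M) * Real.exp (f a) * ∑ b, Real.exp (g b)
        = Real.exp (f a) * (Real.exp (-M) * ∑ b, Real.exp (g b)) := by ring
      _ ≤ Real.exp (g a) * ∑ b, Real.exp (f b) :=
        mul_le_mul (Real.exp_le_exp.2 (hfg a)) hZ' (by have := hpos g; positivity)
          (Real.exp_pos _).le
  have hf0 := div_nonneg (Real.exp_pos (f a)).le (hpos f).le
  have hg0 := div_nonneg (Real.exp_pos (g a)).le (hpos g).le
  rw [abs_le]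
  constructor <;> nlinarith [hle f, hle g]

/-- A table whose entries are bounded by `M` has Euclidean norm at most `√(|S||A|) M`. -/
theorem tnorm_le_of_abs_le {S A : Type*} [Fintype S] [Fintype A] {f : S → A → ℝ} {M : ℝ}
    (hM : 0 ≤ M) (hf : ∀ s a, |f s a| ≤ M) :
    tnorm f ≤ Real.sqrt ((Fintype.card S : ℝ) * (Fintype.card A : ℝ)) * M := by
  calc tnorm f ≤ Real.sqrt (∑ _s : S, ∑ _a : A, M ^ 2) :=
        Real.sqrt_le_sqrt (Finset.sum_le_sum fun s _ => Finset.sum_le_sum fun a _ =>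
          sq_le_sq' (abs_le.1 (hf s a)).1 (abs_le.1 (hf s a)).2)
    _ = Real.sqrt ((Fintype.card S : ℝ) * (Fintype.card A : ℝ)) * M := by
        simp only [Finset.sum_const, Finset.card_univ, nsmul_eq_mul]
        rw [← mul_assoc, Real.sqrt_mul (by positivity), Real.sqrt_sq hM]

/-- one-step drift of the ε-greedy softmax behavior policy under one
natural actor update (corrected constant). -/
theorem behavior_policy_one_step_drift
    {S A : Type*} [Fintype S] [Fintype A] [Nonempty S] [Nonempty A]
    (N : ℕ) (hN : 1 ≤ N)
    (γ : ℝ) (hγ : γ ∈ Set.Ioo (0:ℝ) 1)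
    (ξ : ℝ) (hξ : ξ ∈ Set.Ioc (0:ℝ) 1)
    (α : ℝ) (hα : 0 < α)
    (ε : ℝ) (hε : ε ∈ Set.Icc (0:ℝ) 1)
    (lam : Fin N → ℝ) (hlam : ∀ i, lam i ∈ Set.Icc (0:ℝ) (2/(ξ*(1-γ))))
    (Qh0 : S → A → ℝ) (hQh0 : ∀ s a, Qh0 s a ∈ Set.Icc (0:ℝ) (1/(1-γ)))
    (Qhg : Fin N → S → A → ℝ) (hQhg : ∀ i s a, Qhg i s a ∈ Set.Icc (0:ℝ) (1/(1-γ)))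
    (θ θ' : S → A → ℝ)
    (hθ' : ∀ s a, θ' s a = θ s a + α * (Qh0 s a + ∑ i, lam i * Qhg i s a))
    (πθ πθ' πh πh' : S → A → ℝ)
    (hπθ : ∀ s a, πθ s a = Real.exp (θ s a) / ∑ a', Real.exp (θ s a'))
    (hπθ' : ∀ s a, πθ' s a = Real.exp (θ' s a) / ∑ a', Real.exp (θ' s a'))
    (hπh : ∀ s a, πh s a = ε / (Fintype.card A : ℝ) + (1-ε) * πθ s a)
    (hπh' : ∀ s a, πh' s a = ε / (Fintype.card A : ℝ) + (1-ε) * πθ' s a) :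
    tnorm (fun s a => πh' s a - πh s a)
      ≤ 3 * Real.sqrt ((Fintype.card S : ℝ) * (Fintype.card A : ℝ)) * N * α /
          (ξ * (1-γ)^2) := by
  obtain ⟨hγ0, hγ1⟩ := hγ
  obtain ⟨hξ0, hξ1⟩ := hξ
  obtain ⟨hε0, hε1⟩ := hε
  have hg : 0 < 1 - γ := by linarith
  have hN' : (1 : ℝ) ≤ N := by exact_mod_cast hN
  set M : ℝ := α * (3 * N / (ξ * (1 - γ) ^ 2)) with hMdef
  have hM : 0 ≤ M := by positivity
  have hterm : ∀ i s a, lam i * Qhg i s a ≤ 2 / (ξ * (1 - γ) ^ 2) := fun i s a =>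
    calc lam i * Qhg i s a ≤ 2 / (ξ * (1 - γ)) * (1 / (1 - γ)) :=
          mul_le_mul (hlam i).2 (hQhg i s a).2 (hQhg i s a).1 (by positivity)
      _ = 2 / (ξ * (1 - γ) ^ 2) := by field_simp
  have hfirst : 1 / (1 - γ) ≤ N / (ξ * (1 - γ) ^ 2) :=
    div_le_div₀ (by positivity) hN' (by positivity) (by nlinarith)
  have hQ0 : ∀ s a, 0 ≤ Qh0 s a + ∑ i, lam i * Qhg i s a := fun s a =>
    add_nonneg (hQh0 s a).1
      (Finset.sum_nonneg fun i _ => mul_nonneg (hlam i).1 (hQhg i s a).1)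
  have hQ : ∀ s a, Qh0 s a + ∑ i, lam i * Qhg i s a ≤ 3 * N / (ξ * (1 - γ) ^ 2) := by
    intro s a
    have hsum : ∑ i, lam i * Qhg i s a ≤ N * (2 / (ξ * (1 - γ) ^ 2)) := by
      simpa using Finset.sum_le_card_nsmul Finset.univ _ _ fun i _ => hterm i s a
    calc Qh0 s a + ∑ i, lam i * Qhg i s a
        ≤ N / (ξ * (1 - γ) ^ 2) + N * (2 / (ξ * (1 - γ) ^ 2)) :=
          add_le_add ((hQh0 s a).2.trans hfirst) hsum
      _ = 3 * N / (ξ * (1 - γ) ^ 2) := by ring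
  have hsoft : ∀ s a, |πθ' s a - πθ s a| ≤ M := by
    intro s a
    rw [hπθ, hπθ']
    refine abs_softmax_sub_le (fun b => ?_) (fun b => ?_) a
    · rw [hθ']
      linarith [mul_nonneg hα.le (hQ0 s b)]
    · rw [hθ']
      linarith [mul_le_mul_of_nonneg_left (hQ s b) hα.le]
  have hentry : ∀ s a, |πh' s a - πh s a| ≤ M := by
    intro s a
    have heq : πh' s a - πh s a = (1 - ε) * (πθ' s a - πθ s a) := by
      rw [hπh, hπh']
      ring
    rw [heq, abs_mul, abs_of_nonneg (by linarith : 0 ≤ 1 - ε)]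
    exact (mul_le_of_le_one_left (abs_nonneg _) (by linarith)).trans (hsoft s a)
  calc tnorm (fun s a => πh' s a - πh s a)
      ≤ Real.sqrt ((Fintype.card S : ℝ) * (Fintype.card A : ℝ)) * M :=
        tnorm_le_of_abs_le hM hentry
    _ = 3 * Real.sqrt ((Fintype.card S : ℝ) * (Fintype.card A : ℝ)) * N * α /
          (ξ * (1 - γ) ^ 2) := by
        rw [hMdef]
        ring
end

section
/- Existence of a policy realizing a convex combination of discounted values. Let π₁ and π₂ be policies, ρ a probability distribution on S, and a ∈ [0,1]. Then there exists a policy π such that for every reward function r : S×A → ℝ, V_r^π(ρ) = a·V_r^{π₁}(ρ) + (1−a)·V_r^{π₂}(ρ), where Q_r^π is the unique solution of Q_r^π = r + γ P^π Q_r^π, V_r^π(s) = ∑_a π(a|s) Q_r^π(s,a), and V_r^π(ρ) = ∑_s ρ(s) V_r^π(s). -/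
open Finset

/-- The initial distribution `ρ` pushed `k` steps forward by the transition matrix `K`. -/
def stepDist {S : Type*} [Fintype S] (K : S → S → ℝ) (ρ : S → ℝ) : ℕ → S → ℝ
  | 0 => ρ
  | k + 1 => fun s' => ∑ s, stepDist K ρ k s * K s s'

theorem IsDist.stepDist {S : Type*} [Fintype S] {K : S → S → ℝ} (hK : ∀ s, IsDist (K s))
    {ρ : S → ℝ} (hρ : IsDist ρ) (k : ℕ) : IsDist (stepDist K ρ k) := by
  induction k with
  | zero => exact hρ
  | succ k ih =>
    refine ⟨fun s' => Finset.sum_nonneg fun s _ => mul_nonneg (ih.1 s) ((hK s).1 s'), ?_⟩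
    simp only [_root_.stepDist]
    rw [Finset.sum_comm]
    simp_rw [← Finset.mul_sum, (hK _).2, mul_one]
    exact ih.2

theorem IsDist.le_one {S : Type*} [Fintype S] {ρ : S → ℝ} (hρ : IsDist ρ) (s : S) : ρ s ≤ 1 :=
  hρ.2 ▸ Finset.single_le_sum (fun i _ => hρ.1 i) (Finset.mem_univ s)

/-- The discounted balance equation of a transition matrix has a nonnegative solution. -/
theorem exists_discounted_flow {S : Type*} [Fintype S] {K : S → S → ℝ} (hK : ∀ s, IsDist (K s))
    {ρ : S → ℝ} (hρ : IsDist ρ) {γ : ℝ} (hγ : γ ∈ Set.Ioo (0 : ℝ) 1) :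
    ∃ d : S → ℝ, (∀ s, 0 ≤ d s) ∧ ∀ s', d s' = ρ s' + γ * ∑ s, d s * K s s' := by
  have hu := hρ.stepDist hK
  have hsum (s : S) : Summable fun k => γ ^ k * stepDist K ρ k s :=
    Summable.of_nonneg_of_le (fun k => mul_nonneg (pow_nonneg hγ.1.le k) ((hu k).1 s))
      (fun k => mul_le_of_le_one_right (pow_nonneg hγ.1.le k) ((hu k).le_one s))
      (summable_geometric_of_lt_one hγ.1.le hγ.2)
  refine ⟨fun s => ∑' k, γ ^ k * stepDist K ρ k s,
    fun s => tsum_nonneg fun k => mul_nonneg (pow_nonneg hγ.1.le k) ((hu k).1 s), fun s' => ?_⟩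
  beta_reduce
  rw [(hsum s').tsum_eq_zero_add]
  simp_rw [← tsum_mul_right]
  rw [← Summable.tsum_finsetSum fun s _ => (hsum s).mul_right _, ← tsum_mul_left]
  simp only [pow_zero, one_mul, stepDist, Finset.mul_sum]
  congr 1
  refine tsum_congr fun k => Finset.sum_congr rfl fun s _ => ?_
  ring

/-- `d` is a discounted state occupancy measure of `π` with initial distribution `ρ`. -/
def IsOccupancy {S A : Type*} [Fintype S] [Fintype A] (P : S → A → S → ℝ) (γ : ℝ) (ρ : S → ℝ)
    (π : S → A → ℝ) (d : S → ℝ) : Prop :=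
  ∀ s', d s' = ρ s' + γ * ∑ s, ∑ a, d s * π s a * P s a s'

theorem exists_isOccupancy {S A : Type*} [Fintype S] [Fintype A] {P : S → A → S → ℝ}
    (hP : IsKernel P) {γ : ℝ} (hγ : γ ∈ Set.Ioo (0 : ℝ) 1) {ρ : S → ℝ} (hρ : IsDist ρ)
    {π : S → A → ℝ} (hπ : IsPolicy π) :
    ∃ d : S → ℝ, (∀ s, 0 ≤ d s) ∧ IsOccupancy P γ ρ π d := by
  have hK (s : S) : IsDist fun s' => ∑ a, π s a * P s a s' := by
    refine ⟨fun s' => Finset.sum_nonneg fun a _ => mul_nonneg (hπ.1 s a) (hP.1 s a s'), ?_⟩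
    rw [Finset.sum_comm]
    simp_rw [← Finset.mul_sum, hP.2, mul_one]
    exact hπ.2 s
  obtain ⟨d, hd, h⟩ := exists_discounted_flow hK hρ hγ
  refine ⟨d, hd, fun s' => ?_⟩
  simpa only [Finset.mul_sum, mul_assoc] using h s'

/-- The value is the reward integrated against the discounted occupancy measure. -/
theorem IsOccupancy.vval_eq {S A : Type*} [Fintype S] [Fintype A] {P : S → A → S → ℝ} {γ : ℝ}
    {ρ : S → ℝ} {π : S → A → ℝ} {d : S → ℝ} (hd : IsOccupancy P γ ρ π d)
    {r Q : S → A → ℝ} (hQ : IsBellman P γ r π Q) :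
    Vval ρ π Q = ∑ s, ∑ a, d s * π s a * r s a := by
  set V : S → ℝ := fun s => ∑ a, π s a * Q s a
  have hbalance : ∑ s, d s * V s =
      ∑ s, ρ s * V s + γ * ∑ s, ∑ a, d s * π s a * ∑ s', P s a s' * V s' := by
    have hcomm : ∑ s, ∑ a, d s * π s a * ∑ s', P s a s' * V s' =
        ∑ s', (∑ s, ∑ a, d s * π s a * P s a s') * V s' := by
      simp_rw [Finset.mul_sum, Finset.sum_mul, ← mul_assoc]
      exact Finset.sum_comm_cycle
    rw [hcomm, Finset.mul_sum, ← Finset.sum_add_distrib]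
    refine Finset.sum_congr rfl fun s _ => ?_
    rw [hd s]
    ring
  have hreward : ∑ s, d s * V s = ∑ s, ∑ a, d s * π s a * r s a +
      γ * ∑ s, ∑ a, d s * π s a * ∑ s', P s a s' * V s' := by
    rw [Finset.mul_sum, ← Finset.sum_add_distrib]
    refine Finset.sum_congr rfl fun s _ => ?_
    rw [Finset.mul_sum, Finset.mul_sum, ← Finset.sum_add_distrib]
    refine Finset.sum_congr rfl fun a _ => ?_
    have hQsa : Q s a = r s a + γ * ∑ s', P s a s' * V s' := hQ s a
    rw [hQsa]
    ring
  exact add_right_cancel (hbalance.symm.trans hreward)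

/-- A state–action measure that is a nonnegative combination of measures disintegrating through
policies disintegrates through a policy. -/
theorem exists_isPolicy_mixture {S A : Type*} [Fintype A] {π₁ π₂ : S → A → ℝ}
    (hπ₁ : IsPolicy π₁) (hπ₂ : IsPolicy π₂) {x y : S → ℝ} (hx : ∀ s, 0 ≤ x s)
    (hy : ∀ s, 0 ≤ y s) :
    ∃ π, IsPolicy π ∧ ∀ s a, (x s + y s) * π s a = x s * π₁ s a + y s * π₂ s a := by
  have hpoint (s : S) : ∃ p : A → ℝ, ((∀ a, 0 ≤ p a) ∧ ∑ a, p a = 1) ∧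
      ∀ a, (x s + y s) * p a = x s * π₁ s a + y s * π₂ s a := by
    rcases eq_or_ne (x s + y s) 0 with h | h
    · have hx0 : x s = 0 := by linarith [hx s, hy s]
      have hy0 : y s = 0 := by linarith
      exact ⟨π₁ s, ⟨hπ₁.1 s, hπ₁.2 s⟩, fun a => by simp [hx0, hy0]⟩
    · refine ⟨fun a => (x s * π₁ s a + y s * π₂ s a) / (x s + y s), ⟨fun a => ?_, ?_⟩,
        fun a => mul_div_cancel₀ _ h⟩
      · exact div_nonneg (add_nonneg (mul_nonneg (hx s) (hπ₁.1 s a))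
          (mul_nonneg (hy s) (hπ₂.1 s a))) (add_nonneg (hx s) (hy s))
      · rw [← Finset.sum_div, Finset.sum_add_distrib, ← Finset.mul_sum, ← Finset.mul_sum,
          hπ₁.2, hπ₂.2, mul_one, mul_one, div_self h]
  choose π hπ hmix using hpoint
  exact ⟨π, ⟨fun s => (hπ s).1, fun s => (hπ s).2⟩, hmix⟩

/-- existence of a policy realizing a convex combination of discounted
values, simultaneously for every reward function. -/
theorem mixture_policy_exists
    {S A : Type*} [Fintype S] [Fintype A] [Nonempty S] [Nonempty A]
    (P : S → A → S → ℝ) (hP : IsKernel P)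
    (γ : ℝ) (hγ : γ ∈ Set.Ioo (0:ℝ) 1)
    (ρ : S → ℝ) (hρ : IsDist ρ)
    (π₁ π₂ : S → A → ℝ) (hπ₁ : IsPolicy π₁) (hπ₂ : IsPolicy π₂)
    (a : ℝ) (ha : a ∈ Set.Icc (0:ℝ) 1) :
    ∃ π, IsPolicy π ∧ ∀ (r : S → A → ℝ) (Q₁ Q₂ Q : S → A → ℝ),
      IsBellman P γ r π₁ Q₁ → IsBellman P γ r π₂ Q₂ → IsBellman P γ r π Q →
      Vval ρ π Q = a * Vval ρ π₁ Q₁ + (1-a) * Vval ρ π₂ Q₂ := by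
  obtain ⟨d₁, hd₁, hocc₁⟩ := exists_isOccupancy hP hγ hρ hπ₁
  obtain ⟨d₂, hd₂, hocc₂⟩ := exists_isOccupancy hP hγ hρ hπ₂
  obtain ⟨π, hπ, hmix⟩ := exists_isPolicy_mixture hπ₁ hπ₂
    (fun s => mul_nonneg ha.1 (hd₁ s)) (fun s => mul_nonneg (sub_nonneg.2 ha.2) (hd₂ s))
  have hlin (f : S → A → ℝ) : ∑ s, ∑ b, (a * d₁ s + (1 - a) * d₂ s) * π s b * f s b =
      a * ∑ s, ∑ b, d₁ s * π₁ s b * f s b + (1 - a) * ∑ s, ∑ b, d₂ s * π₂ s b * f s b := by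
    simp_rw [Finset.mul_sum, ← Finset.sum_add_distrib, hmix]
    refine Finset.sum_congr rfl fun s _ => Finset.sum_congr rfl fun b _ => ?_
    ring
  have hocc : IsOccupancy P γ ρ π fun s => a * d₁ s + (1 - a) * d₂ s := fun s' => by
    simp only [hlin fun s b => P s b s']
    linear_combination a * hocc₁ s' + (1 - a) * hocc₂ s'
  refine ⟨π, hπ, fun r Q₁ Q₂ Q hQ₁ hQ₂ hQ => ?_⟩
  rw [hocc.vval_eq hQ, hocc₁.vval_eq hQ₁, hocc₂.vval_eq hQ₂, hlin]
end
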